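/- arXiv:2001.11550 — 5 statements merged into one kernel-verified Lean document; each statement's English description precedes it below -/
import Mathlib

section
/- Let N ≥ 1 and d ≥ 1 be integers. For each i,k ∈ {1,…,N} let Φ_{ik} : [0,∞) → [0,∞) be a bounded measurable nonnegative function, and let v_1,…,v_N : [0,∞) → ℝ^d be locally Lipschitz functions satisfying, for almost every t ≥ 0, v_i'(t) = Σ_{k=1}^N Φ_{ik}(t) (v_k(t) − v_i(t)). Then the maximal velocity fluctuation V(t) := max_{i,j ∈ {1,…,N}} |v_i(t) − v_j(t)| is nonincreasing: V(t) ≤ V(s) for all 0 ≤ s ≤ t. -/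
open MeasureTheory

/-- An absolutely continuous function whose derivative is almost everywhere nonpositive does not
increase between the endpoints. -/
lemma AbsolutelyContinuousOnInterval.le_of_ae_deriv_nonpos {f : ℝ → ℝ} {a b : ℝ}
    (hf : AbsolutelyContinuousOnInterval f a b) (hab : a ≤ b)
    (h : ∀ᵐ x : ℝ, x ∈ Set.Icc a b → deriv f x ≤ 0) : f b ≤ f a := by
  have hint := hf.integral_deriv_eq_sub
  have hneg : 0 ≤ ∫ x in a..b, -deriv f x := by
    refine intervalIntegral.integral_nonneg_of_ae_restrict hab ?_
    filter_upwards [(ae_restrict_iff' measurableSet_Icc).mpr h] with x hx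
    simpa using hx
  rw [intervalIntegral.integral_neg] at hneg
  linarith

/-- A finite supremum of functions that are Lipschitz with a common constant is Lipschitz. -/
lemma LipschitzOnWith.ciSup_of_finite {α ι : Type*} [PseudoMetricSpace α] [Finite ι] [Nonempty ι]
    {f : ι → α → ℝ} {K : NNReal} {S : Set α} (hf : ∀ i, LipschitzOnWith K (f i) S) :
    LipschitzOnWith K (fun x => ⨆ i, f i x) S := by
  refine LipschitzOnWith.of_le_add_mul K fun x hx y hy => ciSup_le fun i => ?_
  have h1 : f i y ≤ ⨆ i, f i y := le_ciSup (f := fun i => f i y) (Set.finite_range _).bddAbove i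
  have h2 := (lipschitzOnWith_iff_dist_le_mul.mp (hf i)) x hx y hy
  have h3 := le_abs_self (f i x - f i y)
  rw [Real.dist_eq] at h2
  linarith

/-- If `y` and `z` are at maximal distance among finitely many points `w k`, then moving them by
nonnegative combinations of the relative positions does not increase their distance to first
order. -/
lemma inner_sub_sum_smul_sub_nonpos {E ι : Type*} [NormedAddCommGroup E] [InnerProductSpace ℝ E]
    [Fintype ι] {w : ι → E} {y z : E} {a b : ι → ℝ} (ha : ∀ k, 0 ≤ a k) (hb : ∀ k, 0 ≤ b k)
    (hy : ∀ k, ‖w k - z‖ ≤ ‖y - z‖) (hz : ∀ k, ‖y - w k‖ ≤ ‖y - z‖) :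
    inner ℝ (y - z) (∑ k, a k • (w k - y) - ∑ k, b k • (w k - z)) ≤ 0 := by
  have hself : inner ℝ (y - z) (y - z) = ‖y - z‖ * ‖y - z‖ := real_inner_self_eq_norm_mul_norm _
  rw [inner_sub_right, inner_sum, inner_sum]
  have h1 : ∑ k, inner ℝ (y - z) (a k • (w k - y)) ≤ 0 := by
    refine Finset.sum_nonpos fun k _ => ?_
    rw [real_inner_smul_right]
    refine mul_nonpos_of_nonneg_of_nonpos (ha k) ?_
    have e : w k - y = (w k - z) - (y - z) := by abel
    rw [e, inner_sub_right, hself]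
    have := real_inner_le_norm (y - z) (w k - z)
    nlinarith [mul_le_mul_of_nonneg_left (hy k) (norm_nonneg (y - z))]
  have h2 : 0 ≤ ∑ k, inner ℝ (y - z) (b k • (w k - z)) := by
    refine Finset.sum_nonneg fun k _ => ?_
    rw [real_inner_smul_right]
    refine mul_nonneg (hb k) ?_
    have e : w k - z = (y - z) - (y - w k) := by abel
    rw [e, inner_sub_right, hself]
    have := real_inner_le_norm (y - z) (y - w k)
    nlinarith [mul_le_mul_of_nonneg_left (hz k) (norm_nonneg (y - z))]
  linarith

/-- If `f` touches `g` from below at `x`, then the derivative of `g` at `x`, or the default value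
`0`, is nonpositive as soon as the derivative of `f` is. -/
lemma deriv_nonpos_of_le_of_eq {f g : ℝ → ℝ} {f' x : ℝ} (hle : ∀ y, f y ≤ g y) (heq : f x = g x)
    (hf : HasDerivAt f f' x) (hf' : f' ≤ 0) : deriv g x ≤ 0 := by
  by_cases hg : DifferentiableAt ℝ g x
  · have hmin : IsLocalMin (g - f) x :=
      Filter.Eventually.of_forall fun y => by simpa [heq] using hle y
    have := hmin.hasDerivAt_eq_zero (hg.hasDerivAt.sub hf)
    linarith
  · exact (deriv_zero_of_not_differentiableAt hg).le

/-- Fluctuation-decay part of Theorem 1.1: for a linear consensus system with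
time-dependent nonnegative bounded measurable interaction weights, the maximal
velocity fluctuation `V(t) = max_{i,j} |v_i(t) - v_j(t)|` is nonincreasing. -/
theorem stmt_0 (N d : ℕ) (hN : 1 ≤ N) (hd : 1 ≤ d)
    (Φ : Fin N → Fin N → ℝ → ℝ) (C : ℝ)
    (hΦmeas : ∀ i k, Measurable (Φ i k))
    (hΦnonneg : ∀ i k t, 0 ≤ t → 0 ≤ Φ i k t)
    (hΦbdd : ∀ i k t, 0 ≤ t → Φ i k t ≤ C)
    (v : Fin N → ℝ → EuclideanSpace ℝ (Fin d))
    (hvLip : ∀ i, LocallyLipschitz (v i))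
    (hode : ∀ i, ∀ᵐ t : ℝ, 0 ≤ t →
      HasDerivAt (v i) (∑ k, Φ i k t • (v k t - v i t)) t)
    (s t : ℝ) (hs : 0 ≤ s) (hst : s ≤ t) :
    (⨆ p : Fin N × Fin N, ‖v p.1 t - v p.2 t‖) ≤
      ⨆ p : Fin N × Fin N, ‖v p.1 s - v p.2 s‖ := by
  have : Nonempty (Fin N) := ⟨⟨0, hN⟩⟩
  set V : ℝ → ℝ := fun x => ⨆ p : Fin N × Fin N, ‖v p.1 x - v p.2 x‖
  have hle : ∀ i j x, ‖v i x - v j x‖ ≤ V x := fun i j x =>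
    le_ciSup (f := fun p : Fin N × Fin N => ‖v p.1 x - v p.2 x‖)
      (Set.finite_range _).bddAbove (i, j)
  have hV0 : ∀ x, 0 ≤ V x := fun x => Real.iSup_nonneg fun _ => norm_nonneg _
  choose K hK using fun i =>
    ((hvLip i).locallyLipschitzOn (s := Set.uIcc s t)).exists_lipschitzOnWith_of_compact
      isCompact_uIcc
  have hVLip : LipschitzOnWith (∑ i, K i + ∑ i, K i) V (Set.uIcc s t) := by
    refine LipschitzOnWith.ciSup_of_finite fun p => ?_
    have hKle : ∀ i, K i ≤ ∑ i, K i := fun i =>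
      Finset.single_le_sum (fun _ _ => zero_le) (Finset.mem_univ i)
    have := lipschitzWith_one_norm.comp_lipschitzOnWith
      (((hK p.1).weaken (hKle _)).sub ((hK p.2).weaken (hKle _)))
    simpa [Function.comp_def] using this
  have hAC := hVLip.absolutelyContinuousOnInterval
  have hsq : V t * V t ≤ V s * V s := by
    refine (hAC.mul hAC).le_of_ae_deriv_nonpos hst ?_
    filter_upwards [ae_all_iff.mpr hode] with x hx hxst
    have hx0 : 0 ≤ x := hs.trans hxst.1
    obtain ⟨⟨i, j⟩, hij⟩ :=
      exists_eq_ciSup_of_finite (f := fun p : Fin N × Fin N => ‖v p.1 x - v p.2 x‖)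
    change ‖v i x - v j x‖ = V x at hij
    refine deriv_nonpos_of_le_of_eq (f := fun y => ‖v i y - v j y‖ ^ 2) (fun y => ?_) ?_
      ((hx i hx0).sub (hx j hx0)).norm_sq ?_
    · simpa [sq] using mul_self_le_mul_self (norm_nonneg _) (hle i j y)
    · simp [sq, hij]
    · have := inner_sub_sum_smul_sub_nonpos (w := fun k => v k x)
        (fun k => hΦnonneg i k x hx0) (fun k => hΦnonneg j k x hx0)
        (fun k => (hle k j x).trans_eq hij.symm) (fun k => (hle i k x).trans_eq hij.symm)
      exact mul_nonpos_of_nonneg_of_nonpos zero_le_two this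
  exact abs_le_of_sq_le_sq' (by simpa [sq] using hsq) (hV0 s) |>.2
end

section
/- Let N ≥ 1, d ≥ 1, η > 0. For each i,k ∈ {1,…,N} let Φ_{ik} : [0,∞) → ℝ be a bounded measurable function with Φ_{ik}(t) ≥ 2η for all t ≥ 0, and let v_1,…,v_N : [0,∞) → ℝ^d be locally Lipschitz functions satisfying, for almost every t ≥ 0, v_i'(t) = Σ_{k=1}^N Φ_{ik}(t) (v_k(t) − v_i(t)). Then the maximal velocity fluctuation V(t) := max_{i,j} |v_i(t) − v_j(t)| satisfies V(t) ≤ e^{−Nηt} V(0) for all t ≥ 0. -/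
open MeasureTheory

open scoped InnerProductSpace NNReal

/-- A finite pointwise supremum of real-valued Lipschitz functions is Lipschitz. -/
lemma LipschitzOnWith.iSup_of_fintype {α ι : Type*} [PseudoMetricSpace α] [Fintype ι]
    [Nonempty ι] {s : Set α} {f : ι → α → ℝ} {K : ι → ℝ≥0}
    (hf : ∀ i, LipschitzOnWith (K i) (f i) s) :
    LipschitzOnWith (∑ i, K i) (fun x ↦ ⨆ i, f i x) s := by
  refine LipschitzOnWith.of_le_add_mul _ fun x hx y hy ↦ ciSup_le fun i ↦ ?_
  calc f i x ≤ f i y + K i * dist x y := (hf i).le_add_mul hx hy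
    _ ≤ (⨆ j, f j y) + (∑ j, K j : ℝ≥0) * dist x y := by
      gcongr
      · exact le_ciSup (f := fun j ↦ f j y) (Set.finite_range _).bddAbove i
      · exact Finset.single_le_sum (fun _ _ ↦ zero_le) (Finset.mem_univ i)

/-- Grönwall's inequality with exponential decay for absolutely continuous functions. -/
lemma AbsolutelyContinuousOnInterval.le_exp_mul_of_ae_deriv_le {W : ℝ → ℝ} {c T : ℝ}
    (hT : 0 ≤ T) (hW : AbsolutelyContinuousOnInterval W 0 T)
    (hderiv : ∀ᵐ x : ℝ, x ∈ Set.Icc 0 T → deriv W x ≤ -c * W x) :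
    W T ≤ Real.exp (-c * T) * W 0 := by
  have hg := AbsolutelyContinuousOnInterval.mul
    (f := fun x ↦ Real.exp (c * x)) (a := 0) (b := T)
    (ContDiffOn.absolutelyContinuousOnInterval (by fun_prop)) hW
  have hint := hg.integral_deriv_eq_sub
  have hnonpos : ∫ x in (0 : ℝ)..T, deriv ((fun x ↦ Real.exp (c * x)) * W) x ≤ 0 := by
    rw [← neg_nonneg, ← intervalIntegral.integral_neg]
    refine intervalIntegral.integral_nonneg_of_ae_restrict hT ?_
    rw [Filter.EventuallyLE, ae_restrict_iff' measurableSet_Icc]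
    filter_upwards [hderiv, hW.ae_differentiableAt] with x hx hdiff hmem
    rw [Set.uIcc_of_le hT] at hdiff
    have hexp : HasDerivAt (fun x ↦ Real.exp (c * x)) (Real.exp (c * x) * c) x := by
      simpa using ((hasDerivAt_id x).const_mul c).exp
    rw [(hexp.mul (hdiff hmem).hasDerivAt).deriv]
    have := mul_le_mul_of_nonneg_left (hx hmem) (Real.exp_pos (c * x)).le
    simp only [Pi.zero_apply]
    linarith
  rw [hint] at hnonpos
  simp only [Pi.mul_apply, mul_zero, Real.exp_zero, one_mul, sub_nonpos] at hnonpos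
  calc W T = Real.exp (-c * T) * (Real.exp (c * T) * W T) := by
        rw [← mul_assoc, ← Real.exp_add]; simp
    _ ≤ Real.exp (-c * T) * W 0 := by gcongr

section Diameter

variable {ι E : Type*} [NormedAddCommGroup E] [InnerProductSpace ℝ E]

/-- If `z` is no farther from `y` than `x` is, then moving from `x` towards `z` does not increase
the distance to `y` to first order. -/
lemma inner_sub_sub_nonpos_of_norm_sub_le {x y z : E} (h : ‖z - y‖ ≤ ‖x - y‖) :
    ⟪x - y, z - x⟫_ℝ ≤ 0 := by
  have hsq : ‖z - y‖ ^ 2 ≤ ‖x - y‖ ^ 2 := by gcongr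
  have hadd := norm_add_sq_real (x - y) (z - x)
  rw [show x - y + (z - x) = z - y by abel] at hadd
  nlinarith [sq_nonneg ‖z - x‖]

/-- Dissipation of the diameter of a consensus dynamics with weights bounded below. -/
lemma inner_sub_consensus_sub_le [Fintype ι] {w : ι → ι → ℝ} {η : ℝ} {x : ι → E} {i j : ι}
    (hw : ∀ l k, 2 * η ≤ w l k) (hmax : ∀ l k, ‖x l - x k‖ ≤ ‖x i - x j‖) :
    ⟪x i - x j, (∑ k, w i k • (x k - x i)) - ∑ k, w j k • (x k - x j)⟫_ℝ ≤
      -(2 * η * Fintype.card ι) * ‖x i - x j‖ ^ 2 := by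
  rw [← Finset.sum_sub_distrib, inner_sum]
  calc ∑ k, ⟪x i - x j, w i k • (x k - x i) - w j k • (x k - x j)⟫_ℝ
      ≤ ∑ _k : ι, -(2 * η * ‖x i - x j‖ ^ 2) := by
        refine Finset.sum_le_sum fun k _ ↦ ?_
        have hi : ⟪x i - x j, x k - x i⟫_ℝ ≤ 0 := inner_sub_sub_nonpos_of_norm_sub_le (hmax k j)
        have hj : ⟪x j - x i, x k - x j⟫_ℝ ≤ 0 :=
          inner_sub_sub_nonpos_of_norm_sub_le ((hmax k i).trans_eq (norm_sub_rev _ _))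
        rw [← neg_sub (x i) (x j), inner_neg_left] at hj
        have hsplit : ⟪x i - x j, x k - x j⟫_ℝ =
            ‖x i - x j‖ ^ 2 + ⟪x i - x j, x k - x i⟫_ℝ := by
          rw [← real_inner_self_eq_norm_sq, ← inner_add_right]
          congr 1
          abel
        rw [inner_sub_right, real_inner_smul_right, real_inner_smul_right]
        have hwi := mul_le_mul_of_nonpos_right (hw i k) hi
        have hwj := mul_le_mul_of_nonneg_right (hw j k) (neg_nonpos.mp hj)
        linear_combination hwi + hwj - 2 * η * hsplit
    _ = -(2 * η * Fintype.card ι) * ‖x i - x j‖ ^ 2 := by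
        simp only [Finset.sum_const, Finset.card_univ, nsmul_eq_mul]
        ring

/-- The derivative of the squared diameter of finitely many moving points is the derivative of the
squared distance between any two points realizing the diameter. -/
lemma exists_deriv_iSup_norm_sub_sq [Finite ι] [Nonempty ι] {v : ι → ℝ → E} {v' : ι → E} {s : ℝ}
    (hv : ∀ i, HasDerivAt (v i) (v' i) s)
    (hW : DifferentiableAt ℝ (fun r ↦ (⨆ p : ι × ι, ‖v p.1 r - v p.2 r‖) ^ 2) s) :
    ∃ i j, (⨆ p : ι × ι, ‖v p.1 s - v p.2 s‖) = ‖v i s - v j s‖ ∧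
      deriv (fun r ↦ (⨆ p : ι × ι, ‖v p.1 r - v p.2 r‖) ^ 2) s =
        2 * ⟪v i s - v j s, v' i - v' j⟫_ℝ := by
  obtain ⟨⟨i, j⟩, hij⟩ := exists_eq_ciSup_of_finite (f := fun p : ι × ι ↦ ‖v p.1 s - v p.2 s‖)
  refine ⟨i, j, hij.symm, ?_⟩
  have hsub := ((hv i).sub (hv j)).norm_sq.sub hW.hasDerivAt
  have hlocal : IsLocalMax ((fun r ↦ ‖(v i - v j) r‖ ^ 2) -
      fun r ↦ (⨆ p : ι × ι, ‖v p.1 r - v p.2 r‖) ^ 2) s := by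
    refine Filter.Eventually.of_forall fun r ↦ ?_
    have hle : ‖v i r - v j r‖ ≤ ⨆ p : ι × ι, ‖v p.1 r - v p.2 r‖ :=
      le_ciSup (f := fun p : ι × ι ↦ ‖v p.1 r - v p.2 r‖) (Set.finite_range _).bddAbove (i, j)
    simp only [Pi.sub_apply, ← hij, sub_self, sub_nonpos]
    gcongr
  exact (sub_eq_zero.mp (hlocal.hasDerivAt_eq_zero hsub)).symm

end Diameter

/-- The diameter of finitely many locally Lipschitz curves is absolutely continuous. -/
lemma absolutelyContinuousOnInterval_iSup_norm_sub {ι E : Type*} [Fintype ι] [Nonempty ι]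
    [SeminormedAddCommGroup E] {v : ι → ℝ → E} (hv : ∀ i, LocallyLipschitz (v i)) (a b : ℝ) :
    AbsolutelyContinuousOnInterval (fun r ↦ ⨆ p : ι × ι, ‖v p.1 r - v p.2 r‖) a b := by
  choose K hK using fun i ↦ ((hv i).locallyLipschitzOn
    (s := Set.uIcc a b)).exists_lipschitzOnWith_of_compact isCompact_uIcc
  refine (LipschitzOnWith.iSup_of_fintype (K := fun p : ι × ι ↦ 1 * (K p.1 + K p.2))
    fun p ↦ ?_).absolutelyContinuousOnInterval
  exact lipschitzWith_one_norm.comp_lipschitzOnWith ((hK p.1).sub (hK p.2))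

/-- Quantitative L^∞ estimate from the proof of Theorem 1.1: if all interaction
weights are uniformly bounded below by `2η`, the maximal velocity fluctuation
decays exponentially: `V(t) ≤ exp(-Nηt) V(0)`. -/
theorem stmt_2 (N d : ℕ) (hN : 1 ≤ N) (hd : 1 ≤ d) (η : ℝ) (hη : 0 < η)
    (Φ : Fin N → Fin N → ℝ → ℝ) (C : ℝ)
    (hΦmeas : ∀ i k, Measurable (Φ i k))
    (hΦlb : ∀ i k t, 0 ≤ t → 2 * η ≤ Φ i k t)
    (hΦbdd : ∀ i k t, 0 ≤ t → Φ i k t ≤ C)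
    (v : Fin N → ℝ → EuclideanSpace ℝ (Fin d))
    (hvLip : ∀ i, LocallyLipschitz (v i))
    (hode : ∀ i, ∀ᵐ t : ℝ, 0 ≤ t →
      HasDerivAt (v i) (∑ k, Φ i k t • (v k t - v i t)) t)
    (t : ℝ) (ht : 0 ≤ t) :
    (⨆ p : Fin N × Fin N, ‖v p.1 t - v p.2 t‖) ≤
      Real.exp (-(N : ℝ) * η * t) * ⨆ p : Fin N × Fin N, ‖v p.1 0 - v p.2 0‖ := by
  have : Nonempty (Fin N) := ⟨⟨0, hN⟩⟩
  set V : ℝ → ℝ := fun r ↦ ⨆ p : Fin N × Fin N, ‖v p.1 r - v p.2 r‖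
  have hVnonneg (r : ℝ) : 0 ≤ V r := Real.iSup_nonneg fun _ ↦ norm_nonneg _
  have hVac := absolutelyContinuousOnInterval_iSup_norm_sub hvLip 0 t
  have hWac : AbsolutelyContinuousOnInterval (fun r ↦ V r ^ 2) 0 t := by
    simpa only [sq] using! hVac.mul hVac
  have hdecay : V t ^ 2 ≤ Real.exp (-(2 * (N * η)) * t) * V 0 ^ 2 := by
    refine hWac.le_exp_mul_of_ae_deriv_le ht ?_
    filter_upwards [ae_all_iff.mpr hode, hWac.ae_differentiableAt] with s hs hdiff hmem
    rw [Set.uIcc_of_le ht] at hdiff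
    obtain ⟨i, j, hij, hderiv⟩ :=
      exists_deriv_iSup_norm_sub_sq (fun i ↦ hs i hmem.1) (hdiff hmem)
    have hdiss := inner_sub_consensus_sub_le (w := fun i k ↦ Φ i k s) (x := fun i ↦ v i s)
      (i := i) (j := j) (fun l k ↦ hΦlb l k s hmem.1) fun l k ↦ by
        rw [← hij]
        exact le_ciSup (f := fun p : Fin N × Fin N ↦ ‖v p.1 s - v p.2 s‖)
          (Set.finite_range _).bddAbove (l, k)
    rw [Fintype.card_fin, ← hij] at hdiss
    have hprod : 0 ≤ N * η * V s ^ 2 := by positivity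
    refine hderiv.trans_le ?_
    change _ ≤ -(2 * η * N) * V s ^ 2 at hdiss
    linarith
  refine le_of_sq_le_sq ?_ (mul_nonneg (Real.exp_pos _).le (hVnonneg 0))
  rw [mul_pow, ← Real.exp_nat_mul]
  convert! hdecay using 3
  push_cast
  ring
end

section
/- Let d ≥ 1, N ≥ 1, δ > 0, and let x_1,…,x_N ∈ ℝ^d. Suppose the union ⋃_{k=1}^N B(x_k, δ/2) of the open balls of radius δ/2 centered at the points is a connected subset of ℝ^d. Then the graph on the vertex set {1,…,N} in which i and j are adjacent if and only if |x_i − x_j| < δ is connected: for every i,j ∈ {1,…,N} there exists a finite sequence l_1 = i, l_2, …, l_p = j with |x_{l_k} − x_{l_{k+1}}| < δ for every k ∈ {1,…,p−1}. -/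
/-- Points related by the reflexive transitive closure are joined by a finite chain. -/
theorem Relation.ReflTransGen.exists_fin_chain {α : Type*} {r : α → α → Prop} {a b : α}
    (h : Relation.ReflTransGen r a b) :
    ∃ (p : ℕ) (l : Fin (p + 1) → α), l 0 = a ∧ l (Fin.last p) = b ∧
      ∀ k : Fin p, r (l k.castSucc) (l k.succ) := by
  induction h using Relation.ReflTransGen.head_induction_on with
  | refl => exact ⟨0, fun _ => b, rfl, rfl, fun k => k.elim0⟩
  | @head a c hac _ ih =>
    obtain ⟨p, l, h0, hlast, hl⟩ := ih
    refine ⟨p + 1, Fin.cons a l, rfl, ?_, fun k => ?_⟩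
    · rw [← Fin.succ_last, Fin.cons_succ, hlast]
    · cases k using Fin.cases with
      | zero => simpa [h0] using hac
      | succ k => simpa [← Fin.succ_castSucc] using hl k

/-- If a union of balls of radius `δ / 2` is preconnected, any two centers are joined by a chain
of centers with steps shorter than `δ`. -/
theorem IsPreconnected.reflTransGen_dist_lt_of_iUnion_ball {ι X : Type*} [PseudoMetricSpace X]
    {δ : ℝ} (hδ : 0 < δ) {x : ι → X}
    (h : IsPreconnected (⋃ k, Metric.ball (x k) (δ / 2))) (i j : ι) :
    Relation.ReflTransGen (fun a b => dist (x a) (x b) < δ) i j := by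
  by_contra hij
  let R := Relation.ReflTransGen (fun a b => dist (x a) (x b) < δ) i
  have center_mem (k : ι) : x k ∈ Metric.ball (x k) (δ / 2) := Metric.mem_ball_self (half_pos hδ)
  obtain ⟨y, -, hyu, hyv⟩ := h
    (⋃ (k) (_ : R k), Metric.ball (x k) (δ / 2)) (⋃ (k) (_ : ¬R k), Metric.ball (x k) (δ / 2))
    (isOpen_biUnion fun _ _ => Metric.isOpen_ball) (isOpen_biUnion fun _ _ => Metric.isOpen_ball)
    (Set.iUnion_subset fun k y hy => by
      by_cases hk : R k
      · exact Or.inl (Set.mem_iUnion₂.2 ⟨k, hk, hy⟩)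
      · exact Or.inr (Set.mem_iUnion₂.2 ⟨k, hk, hy⟩))
    ⟨x i, Set.mem_iUnion.2 ⟨i, center_mem i⟩,
      Set.mem_iUnion₂.2 ⟨i, Relation.ReflTransGen.refl, center_mem i⟩⟩
    ⟨x j, Set.mem_iUnion.2 ⟨j, center_mem j⟩, Set.mem_iUnion₂.2 ⟨j, hij, center_mem j⟩⟩
  obtain ⟨a, ha, hya⟩ := Set.mem_iUnion₂.1 hyu
  obtain ⟨b, hb, hyb⟩ := Set.mem_iUnion₂.1 hyv
  refine hb (Relation.ReflTransGen.tail ha ?_)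
  rw [Metric.mem_ball] at hya hyb
  linarith [dist_triangle_left (x a) (x b) y]

/-- Geometric core of Lemma 3.1: if the union of the open balls of radius `δ/2`
centered at `x_1, …, x_N` is connected, then the proximity graph (adjacency:
`|x_i - x_j| < δ`) is connected. -/
theorem stmt_4 (d N : ℕ) (hd : 1 ≤ d) (hN : 1 ≤ N) (δ : ℝ) (hδ : 0 < δ)
    (x : Fin N → EuclideanSpace ℝ (Fin d))
    (hconn : IsConnected (⋃ k, Metric.ball (x k) (δ / 2))) :
    ∀ i j : Fin N, ∃ (p : ℕ) (l : Fin (p + 1) → Fin N),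
      l 0 = i ∧ l (Fin.last p) = j ∧
      ∀ k : Fin p, dist (x (l k.castSucc)) (x (l k.succ)) < δ := by
  intro i j
  exact (hconn.isPreconnected.reflTransGen_dist_lt_of_iUnion_ball hδ i j).exists_fin_chain
end

section
/- Let d ≥ 1, N ≥ 1, δ > 0, m ∈ ℕ, and let x_1,…,x_N ∈ ℝ^d. Define the neighbor relation: k ∈ 𝒩_i if and only if |x_k − x_i| < δ and #{j ∈ {1,…,N} : |x_j − x_i| < δ} > m. Assume (1) the union ⋃_{k=1}^N B(x_k, δ/2) of open balls is connected, and (2) for every k ∈ {1,…,N}, #{j ∈ {1,…,N} : |x_j − x_k| < δ} > m. Then: (i) for all i,j ∈ {1,…,N}, i ∈ 𝒩_j if and only if j ∈ 𝒩_i; and (ii) for all i,j ∈ {1,…,N} there exists a finite sequence l_1 = i, l_2, …, l_p = j such that l_k ∈ 𝒩_{l_{k+1}} for all k ∈ {1,…,p−1}. -/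
/-- The neighbor relation of the density-induced consensus protocol:
`Nbr x δ m k i` means `k ∈ 𝒩_i`, i.e. `x_k ∈ B(x_i, δ)` and the number of
particles in `B(x_i, δ)` exceeds `m`. -/
def Nbr {d N : ℕ} (x : Fin N → EuclideanSpace ℝ (Fin d)) (δ : ℝ) (m : ℕ)
    (k i : Fin N) : Prop :=
  dist (x k) (x i) < δ ∧ m < Set.ncard {j : Fin N | dist (x j) (x i) < δ}

/-- If a union of nonempty open sets is preconnected, any two of the sets are joined by a chain of
sets in which consecutive ones intersect. -/
theorem IsPreconnected.reflTransGen_of_iUnion {ι α : Type*} [TopologicalSpace α] {s : ι → Set α}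
    (h : IsPreconnected (⋃ i, s i)) (ho : ∀ i, IsOpen (s i)) (hne : ∀ i, (s i).Nonempty)
    (i j : ι) : Relation.ReflTransGen (fun a b => (s a ∩ s b).Nonempty) i j := by
  by_contra hij
  let R : ι → Prop := Relation.ReflTransGen (fun a b => (s a ∩ s b).Nonempty) i
  obtain ⟨y, hy⟩ := hne i
  obtain ⟨z, hz⟩ := hne j
  obtain ⟨w, -, hwu, hwv⟩ := h (⋃ a, ⋃ _ : R a, s a) (⋃ a, ⋃ _ : ¬ R a, s a)
    (isOpen_biUnion fun a _ => ho a) (isOpen_biUnion fun a _ => ho a)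
    (Set.iUnion_subset fun a w hw => by
      by_cases ha : R a
      · exact Or.inl (Set.mem_iUnion₂.2 ⟨a, ha, hw⟩)
      · exact Or.inr (Set.mem_iUnion₂.2 ⟨a, ha, hw⟩))
    ⟨y, Set.mem_iUnion.2 ⟨i, hy⟩, Set.mem_iUnion₂.2 ⟨i, .refl, hy⟩⟩
    ⟨z, Set.mem_iUnion.2 ⟨j, hz⟩, Set.mem_iUnion₂.2 ⟨j, hij, hz⟩⟩
  obtain ⟨a, ha, hwa⟩ := Set.mem_iUnion₂.1 hwu
  obtain ⟨b, hb, hwb⟩ := Set.mem_iUnion₂.1 hwv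
  exact hb (ha.tail ⟨w, hwa, hwb⟩)

/-- Lemma 3.1: within a δ-densely packed cluster (the union of the balls of
radius `δ/2` is connected and each ball `B(x_k, δ)` contains more than `m`
particles) the interaction graph is undirected and strongly connected. -/
theorem stmt_5 (d N : ℕ) (hd : 1 ≤ d) (hN : 1 ≤ N) (δ : ℝ) (hδ : 0 < δ) (m : ℕ)
    (x : Fin N → EuclideanSpace ℝ (Fin d))
    (hconn : IsConnected (⋃ k, Metric.ball (x k) (δ / 2)))
    (hdense : ∀ k : Fin N, m < Set.ncard {j : Fin N | dist (x j) (x k) < δ}) :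
    (∀ i j : Fin N, Nbr x δ m i j ↔ Nbr x δ m j i) ∧
    (∀ i j : Fin N, ∃ (p : ℕ) (l : Fin (p + 1) → Fin N),
      l 0 = i ∧ l (Fin.last p) = j ∧
      ∀ k : Fin p, Nbr x δ m (l k.castSucc) (l k.succ)) := by
  refine ⟨fun i j => ?_, fun i j => ?_⟩
  · simp only [Nbr, hdense, and_true, dist_comm (x i)]
  · have hchain := hconn.isPreconnected.reflTransGen_of_iUnion (fun _ => Metric.isOpen_ball)
      (fun _ => Metric.nonempty_ball.2 (half_pos hδ)) i j
    refine (Relation.ReflTransGen.mono ?_ _ _ hchain).exists_fin_chain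
    rintro a b ⟨w, ha, hb⟩
    refine ⟨?_, hdense b⟩
    rw [Metric.mem_ball] at ha hb
    linarith [dist_triangle_left (x a) (x b) w]
end

section
/- Let N ≥ 2 be an integer, let v_c ∈ ℝ be a constant, and let v_a, v_b : [0,∞) → ℝ be twice differentiable functions satisfying v_a'(t) = −(v_a(t) − v_b(t)) and v_b'(t) = −(N−1)(v_b(t) − v_a(t)) − (v_b(t) − v_c) for all t ≥ 0, with v_a(0) = 0 and v_b(0) = 0. Then v_b(t) → v_c and v_a(t) → v_c as t → ∞. -/
open Filter

/-- Exponential decay from a linear differential inequality on `[0, ∞)`. -/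
theorem le_mul_exp_neg_of_deriv_le {f f' : ℝ → ℝ} {k : ℝ}
    (hf : ∀ t, 0 ≤ t → HasDerivAt f (f' t) t) (hle : ∀ t, 0 ≤ t → f' t ≤ -k * f t)
    {t : ℝ} (ht : 0 ≤ t) : f t ≤ f 0 * Real.exp (-k * t) := by
  have hd : ∀ s, 0 ≤ s → HasDerivAt (fun s => f s * Real.exp (k * s))
      ((f' s + k * f s) * Real.exp (k * s)) s := fun s hs => by
    have he : HasDerivAt (fun s => Real.exp (k * s)) (Real.exp (k * s) * k) s := by
      simpa using ((hasDerivAt_id s).const_mul k).exp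
    exact ((hf s hs).mul he).congr_deriv (by ring)
  have hanti : AntitoneOn (fun s => f s * Real.exp (k * s)) (Set.Ici 0) := by
    refine antitoneOn_of_hasDerivWithinAt_nonpos (convex_Ici 0)
      (fun s hs => (hd s hs).continuousAt.continuousWithinAt)
      (fun s hs => (hd s (interior_subset hs)).hasDerivWithinAt) fun s hs => ?_
    have := hle s (interior_subset hs)
    exact mul_nonpos_of_nonpos_of_nonneg (by linarith) (Real.exp_pos _).le
  have h : f t * Real.exp (k * t) ≤ f 0 := by
    simpa using hanti (Set.mem_Ici.2 le_rfl) (Set.mem_Ici.2 ht) ht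
  rwa [neg_mul, Real.exp_neg, ← div_eq_mul_inv, le_div_iff₀ (Real.exp_pos _)]

/-- If the square of `f - c` is eventually dominated by a decaying exponential, `f` tends to `c`. -/
theorem tendsto_of_sq_sub_le_mul_exp_neg {f : ℝ → ℝ} {c C k : ℝ} (hk : 0 < k)
    (h : ∀ t, 0 ≤ t → (f t - c) ^ 2 ≤ C * Real.exp (-k * t)) :
    Tendsto f atTop (nhds c) := by
  have hexp : Tendsto (fun t => C * Real.exp (-k * t)) atTop (nhds 0) := by
    simpa using (Real.tendsto_exp_atBot.comp
      (tendsto_id.const_mul_atTop_of_neg (neg_neg_of_pos hk))).const_mul C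
  have hsq : Tendsto (fun t => (f t - c) ^ 2) atTop (nhds 0) :=
    squeeze_zero' (Eventually.of_forall fun t => sq_nonneg _)
      ((eventually_ge_atTop 0).mono h) hexp
  have habs : Tendsto (fun t => |f t - c|) atTop (nhds 0) := by
    simpa [Real.sqrt_sq_eq_abs] using hsq.sqrt
  exact tendsto_sub_nhds_zero_iff.1 ((tendsto_zero_iff_abs_tendsto_zero _).2 habs)

/-- Long-time behavior underlying the sticking scenario (№ 3) of Section 4:
in the scalar system (4.2) all velocities of the cluster converge to the
constant velocity `v_c` of the singleton. -/
theorem stmt_16 (N : ℕ) (hN : 2 ≤ N) (vc : ℝ)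
    (va vb : ℝ → ℝ)
    (hva : Differentiable ℝ va) (hvb : Differentiable ℝ vb)
    (hva2 : Differentiable ℝ (deriv va)) (hvb2 : Differentiable ℝ (deriv vb))
    (hodea : ∀ t, 0 ≤ t → deriv va t = -(va t - vb t))
    (hodeb : ∀ t, 0 ≤ t →
      deriv vb t = -((N : ℝ) - 1) * (vb t - va t) - (vb t - vc))
    (hva0 : va 0 = 0) (hvb0 : vb 0 = 0) :
    Tendsto vb atTop (nhds vc) ∧ Tendsto va atTop (nhds vc) := by
  obtain ⟨m, hm⟩ : ∃ m : ℝ, m = (N : ℝ) - 1 := ⟨_, rfl⟩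
  have hm1 : 1 ≤ m := by
    have : (2 : ℝ) ≤ N := by exact_mod_cast hN
    linarith
  have hk : 0 < 2 / (2 * m + 1) := by positivity
  -- the energy `m (va - vc)² + (vb - vc)²` decays exponentially
  have hE : ∀ t, 0 ≤ t → HasDerivAt (fun t => m * (va t - vc) ^ 2 + (vb t - vc) ^ 2)
      (-2 * (m * (va t - vb t) ^ 2 + (vb t - vc) ^ 2)) t := fun t ht => by
    have ha := ((hva t).hasDerivAt.sub_const vc).pow 2
    have hb := ((hvb t).hasDerivAt.sub_const vc).pow 2
    refine ((ha.const_mul m).add hb).congr_deriv ?_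
    rw [hodea t ht, hodeb t ht, ← hm]
    push_cast
    ring
  have hle : ∀ t, 0 ≤ t → -2 * (m * (va t - vb t) ^ 2 + (vb t - vc) ^ 2) ≤
      -(2 / (2 * m + 1)) * (m * (va t - vc) ^ 2 + (vb t - vc) ^ 2) := fun t _ => by
    have hsq : (va t - vc) ^ 2 ≤ 2 * (va t - vb t) ^ 2 + 2 * (vb t - vc) ^ 2 := by
      nlinarith [sq_nonneg ((va t - vb t) - (vb t - vc))]
    have hmul := mul_le_mul_of_nonneg_left hsq (by linarith : 0 ≤ m)
    have hm2 : 0 ≤ (2 * m ^ 2 - m) * (va t - vb t) ^ 2 :=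
      mul_nonneg (by nlinarith) (sq_nonneg _)
    rw [neg_mul, neg_mul, neg_le_neg_iff, div_mul_eq_mul_div, div_le_iff₀ (by positivity)]
    nlinarith
  have hdecay := fun t (ht : 0 ≤ t) => le_mul_exp_neg_of_deriv_le hE hle ht
  refine ⟨tendsto_of_sq_sub_le_mul_exp_neg hk fun t ht => le_trans ?_ (hdecay t ht),
    tendsto_of_sq_sub_le_mul_exp_neg hk fun t ht => le_trans ?_ (hdecay t ht)⟩
  · have : 0 ≤ m * (va t - vc) ^ 2 := by positivity
    linarith
  · nlinarith [sq_nonneg (va t - vc), sq_nonneg (vb t - vc)]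
end
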